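/- For every integer n ≥ 3 and every vertex u ∈ V, the probability of the event E_{4,u} — that there exists a four-cycle rooted at u whose edge sequence pattern (writing s for a local edge and w for a long-range edge) is (s,w,s,w) or (w,s,w,s) — satisfies Pr(E_{4,u}) < (16·ζ(3) + 5/4) · ln(n/2)^{−2}. -/

import Mathlib

open scoped Classical
open Finset

/-- Vertex set of the `n × n` torus. -/
abbrev Vx (n : ℕ) := Fin n × Fin n

/-- Toroidal distance on the `n × n` torus. -/
def tdist (n : ℕ) (u v : Vx n) : ℕ :=
  min ((u.1 : ℤ) - (v.1 : ℤ)).natAbs (n - ((u.1 : ℤ) - (v.1 : ℤ)).natAbs) +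
  min ((u.2 : ℤ) - (v.2 : ℤ)).natAbs (n - ((u.2 : ℤ) - (v.2 : ℤ)).natAbs)

/-- The normalizing factor at vertex `u`. -/
noncomputable def Zfac (n : ℕ) (u : Vx n) : ℝ :=
  (∑ w ∈ univ.filter (fun w => w ≠ u), ((tdist n u w : ℝ) ^ 2)⁻¹)⁻¹

/-- The probability mass of the outcome `c : V → V` (the vector of long-range choices)
under the UTSW product measure: each vertex `u` independently chooses `c u = v ≠ u`
with probability `Z · d(u,v)⁻²`. -/
noncomputable def mass (n : ℕ) (c : Vx n → Vx n) : ℝ :=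
  ∏ u : Vx n, if c u = u then 0 else Zfac n u * ((tdist n u (c u) : ℝ) ^ 2)⁻¹

/-- Probability of an event under the UTSW product measure. -/
noncomputable def Pr (n : ℕ) (E : Set (Vx n → Vx n)) : ℝ :=
  ∑ c : Vx n → Vx n, if c ∈ E then mass n c else 0

/-- `{x, y}` is an edge of the UTSW random graph `G(c)`. -/
def isEdge (n : ℕ) (c : Vx n → Vx n) (x y : Vx n) : Prop :=
  x ≠ y ∧ (tdist n x y = 1 ∨ c x = y ∨ c y = x)

/-- `{x, y}` is an edge of `G(c)` of the given kind: local (`w = false`, distance one)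
or long-range (`w = true`, distance not one). -/
def edgeKind (n : ℕ) (c : Vx n → Vx n) (x y : Vx n) (w : Bool) : Prop :=
  isEdge n c x y ∧ (tdist n x y = 1 ↔ w = false)

/-- There is a four-cycle rooted at `u` in `G(c)` whose edge sequence has the local/long-range
pattern `(p₁, p₂, p₃, p₄)` (`false` = local edge, `true` = long-range edge). -/
def cyclePat (n : ℕ) (c : Vx n → Vx n) (u : Vx n) (p₁ p₂ p₃ p₄ : Bool) : Prop :=
  ∃ a b e : Vx n, a ≠ b ∧ a ≠ e ∧ b ≠ e ∧ a ≠ u ∧ b ≠ u ∧ e ≠ u ∧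
    edgeKind n c u a p₁ ∧ edgeKind n c a b p₂ ∧ edgeKind n c b e p₃ ∧ edgeKind n c e u p₄

/-- `ζ(3) = ∑_{i ≥ 1} i⁻³`. -/
noncomputable def zeta3 : ℝ := ∑' i : ℕ, ((i + 1 : ℝ) ^ 3)⁻¹

/-- Distance on the cycle of length `n`. -/
def cdist (n : ℕ) (x w : Fin n) : ℕ :=
  min ((x : ℤ) - (w : ℤ)).natAbs (n - ((x : ℤ) - (w : ℤ)).natAbs)

lemma tdist_eq_cdist (n : ℕ) (u v : Vx n) :
    tdist n u v = cdist n u.1 v.1 + cdist n u.2 v.2 := rfl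

lemma tdist_self (n : ℕ) (u : Vx n) : tdist n u u = 0 := by simp [tdist]

lemma tdist_comm (n : ℕ) (u v : Vx n) : tdist n u v = tdist n v u := by
  simp only [tdist]
  rw [← Int.natAbs_neg ((u.1 : ℤ) - v.1), ← Int.natAbs_neg ((u.2 : ℤ) - v.2), neg_sub, neg_sub]

/-- The sphere of radius `i` around `x` in the cycle consists of at most two points `x ± i`. -/
lemma exists_cdist_sphere_eq_pair (n : ℕ) (x : Fin n) (i : ℕ) (hi : 2 * i ≤ n) :
    ∃ p q : Fin n, univ.filter (fun w => cdist n x w = i) = {p, q} ∧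
      (i = 0 → p = q) ∧ (0 < i → 2 * i < n → p ≠ q) := by
  have hx := x.2
  refine ⟨⟨if x.1 + i < n then x.1 + i else x.1 + i - n, by split_ifs <;> omega⟩,
    ⟨if i ≤ x.1 then x.1 - i else x.1 + n - i, by split_ifs <;> omega⟩, ?_, ?_, ?_⟩
  · ext w
    have hw := w.2
    rw [mem_filter]
    simp only [mem_univ, true_and, mem_insert, mem_singleton, Fin.ext_iff, cdist]
    split_ifs <;> omega
  · intro h
    simp only [Fin.ext_iff]
    split_ifs <;> omega
  · intro h h'
    simp only [ne_eq, Fin.ext_iff]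
    split_ifs <;> omega

lemma two_mul_cdist_le (n : ℕ) (x w : Fin n) : 2 * cdist n x w ≤ n := by
  have := x.2
  have := w.2
  simp only [cdist]
  omega

lemma card_cdist_sphere_le (n : ℕ) (x : Fin n) (i : ℕ) :
    (univ.filter (fun w => cdist n x w = i)).card ≤ if i = 0 then 1 else 2 := by
  by_cases hi : 2 * i ≤ n
  · obtain ⟨p, q, h, h0, -⟩ := exists_cdist_sphere_eq_pair n x i hi
    rw [h]
    split_ifs with hz
    · simp [h0 hz]
    · exact card_le_two
  · rw [filter_false_of_mem]
    · simp
    · intro w _ h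
      have := two_mul_cdist_le n x w
      omega

lemma card_cdist_sphere (n : ℕ) (x : Fin n) (i : ℕ) (hi : 2 * i < n) :
    (univ.filter (fun w => cdist n x w = i)).card = if i = 0 then 1 else 2 := by
  obtain ⟨p, q, h, h0, h1⟩ := exists_cdist_sphere_eq_pair n x i hi.le
  rw [h]
  split_ifs with hz
  · simp [h0 hz]
  · exact card_pair (h1 (Nat.pos_of_ne_zero hz) hi)

lemma card_tdist_sphere_eq_sum (n : ℕ) (u : Vx n) (k : ℕ) :
    (univ.filter (fun w => tdist n u w = k)).card =
      ∑ p ∈ antidiagonal k, (univ.filter (fun w => cdist n u.1 w = p.1)).card *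
        (univ.filter (fun w => cdist n u.2 w = p.2)).card := by
  rw [card_eq_sum_card_fiberwise (f := fun w : Vx n => (cdist n u.1 w.1, cdist n u.2 w.2))
    (t := antidiagonal k)]
  · refine sum_congr rfl fun p hp => ?_
    rw [← card_product]
    congr 1
    ext w
    have := mem_antidiagonal.1 hp
    simp only [mem_filter, mem_univ, true_and, mem_product, Prod.ext_iff]
    rw [tdist_eq_cdist]
    omega
  · intro w hw
    rw [mem_coe, HasAntidiagonal.mem_antidiagonal, ← tdist_eq_cdist]
    exact (mem_filter.1 hw).2

lemma sum_antidiagonal_sphere (k : ℕ) (hk : k ≠ 0) :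
    ∑ p ∈ antidiagonal k, (if p.1 = 0 then 1 else 2) * (if p.2 = 0 then 1 else 2) = 4 * k := by
  obtain ⟨m, rfl⟩ := Nat.exists_eq_succ_of_ne_zero hk
  rw [Nat.sum_antidiagonal_eq_sum_range_succ_mk, sum_range_succ, sum_range_succ']
  have : ∀ i ∈ range m,
      ((if i + 1 = 0 then 1 else 2) * if m.succ - (i + 1) = 0 then 1 else 2) = 4 := by
    intro i hi
    have := mem_range.1 hi
    rw [if_neg (by omega), if_neg (by omega)]
  rw [sum_congr rfl this]
  simp
  ring

lemma card_tdist_sphere_le (n : ℕ) (u : Vx n) (k : ℕ) (hk : k ≠ 0) :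
    (univ.filter (fun w => tdist n u w = k)).card ≤ 4 * k := by
  rw [card_tdist_sphere_eq_sum, ← sum_antidiagonal_sphere k hk]
  exact sum_le_sum fun p _ =>
    Nat.mul_le_mul (card_cdist_sphere_le n u.1 p.1) (card_cdist_sphere_le n u.2 p.2)

lemma card_tdist_sphere (n : ℕ) (u : Vx n) (k : ℕ) (hk : k ≠ 0) (hn : 2 * k < n) :
    (univ.filter (fun w => tdist n u w = k)).card = 4 * k := by
  rw [card_tdist_sphere_eq_sum, ← sum_antidiagonal_sphere k hk]
  refine sum_congr rfl fun p hp => ?_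
  have := mem_antidiagonal.1 hp
  rw [card_cdist_sphere n u.1 p.1 (by omega), card_cdist_sphere n u.2 p.2 (by omega)]

lemma sum_comp_tdist (n : ℕ) (u : Vx n) (g : ℕ → ℝ) (s : Finset ℕ) :
    ∑ w ∈ univ.filter (fun w => tdist n u w ∈ s), g (tdist n u w) =
      ∑ k ∈ s, ((univ.filter (fun w => tdist n u w = k)).card : ℝ) * g k := by
  rw [← sum_fiberwise_of_maps_to (g := fun w => tdist n u w) (t := s) (by simp)]
  refine sum_congr rfl fun k hk => ?_
  rw [filter_filter, ← nsmul_eq_mul, ← sum_const]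
  refine sum_congr ?_ ?_
  · ext w
    simp only [mem_filter, mem_univ, true_and]
    exact ⟨fun h => h.2, fun h => ⟨h ▸ hk, h⟩⟩
  · intro w hw
    rw [(mem_filter.1 hw).2]

lemma summable_zeta3 : Summable fun i : ℕ => ((i + 1 : ℝ) ^ 3)⁻¹ := by
  have h := (summable_nat_add_iff 1).2 (Real.summable_nat_pow_inv (p := 3).2 (by norm_num))
  simpa using h

lemma sum_tdist_pow_four_inv_le (n : ℕ) (u : Vx n) :
    ∑ w, ((tdist n u w : ℝ) ^ 4)⁻¹ ≤ 4 * zeta3 := by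
  have hlt : ∀ w, tdist n u w < n + 1 := by
    intro w
    have := two_mul_cdist_le n u.1 w.1
    have := two_mul_cdist_le n u.2 w.2
    rw [tdist_eq_cdist]
    omega
  have h := sum_comp_tdist n u (fun k => ((k : ℝ) ^ 4)⁻¹) (range (n + 1))
  rw [filter_true_of_mem (fun w _ => mem_range.2 (hlt w))] at h
  rw [h, sum_range_succ']
  simp only [Nat.cast_zero, ne_eq, OfNat.ofNat_ne_zero, not_false_eq_true, zero_pow, inv_zero,
    mul_zero, add_zero]
  calc _ ≤ ∑ k ∈ range n, 4 * ((k + 1 : ℝ) ^ 3)⁻¹ := by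
        refine sum_le_sum fun k _ => ?_
        have hc : ((univ.filter (fun w => tdist n u w = k + 1)).card : ℝ) ≤ 4 * (k + 1) := by
          exact_mod_cast card_tdist_sphere_le n u (k + 1) (by omega)
        calc _ ≤ (4 * (k + 1) : ℝ) * (((k + 1 : ℕ) : ℝ) ^ 4)⁻¹ := by gcongr
          _ = _ := by
            push_cast
            field_simp
    _ ≤ 4 * zeta3 := by
        rw [← mul_sum]
        gcongr
        exact summable_zeta3.sum_le_tsum _ fun i _ => by positivity

lemma four_mul_log_le_sum (n : ℕ) (hn : 3 ≤ n) (u : Vx n) :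
    4 * Real.log ((n : ℝ) / 2) ≤ ∑ w, ((tdist n u w : ℝ) ^ 2)⁻¹ := by
  set m := (n - 1) / 2 with hm
  calc 4 * Real.log ((n : ℝ) / 2) ≤ 4 * Real.log ((m + 1 : ℕ) : ℝ) := by
        have : (n : ℝ) ≤ 2 * ((m + 1 : ℕ) : ℝ) := by exact_mod_cast (by omega : n ≤ 2 * (m + 1))
        have : (3 : ℝ) ≤ n := by exact_mod_cast hn
        gcongr
        linarith
    _ ≤ 4 * (harmonic m : ℝ) := by
        gcongr
        exact log_add_one_le_harmonic m
    _ = ∑ k ∈ Icc 1 m, ((univ.filter (fun w => tdist n u w = k)).card : ℝ) * ((k : ℝ) ^ 2)⁻¹ := by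
        rw [harmonic_eq_sum_Icc]
        push_cast
        rw [mul_sum]
        refine sum_congr rfl fun k hk => ?_
        have := mem_Icc.1 hk
        rw [card_tdist_sphere n u k (by omega) (by omega)]
        have : (k : ℝ) ≠ 0 := by exact_mod_cast (by omega : k ≠ 0)
        push_cast
        field_simp
    _ = ∑ w ∈ univ.filter (fun w => tdist n u w ∈ Icc 1 m), ((tdist n u w : ℝ) ^ 2)⁻¹ :=
        (sum_comp_tdist n u (fun k => ((k : ℝ) ^ 2)⁻¹) _).symm
    _ ≤ _ := sum_le_sum_of_subset_of_nonneg (filter_subset _ _) fun _ _ _ => by positivity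

lemma log_half_pos (n : ℕ) (hn : 3 ≤ n) : 0 < Real.log ((n : ℝ) / 2) := by
  have : (3 : ℝ) ≤ n := by exact_mod_cast hn
  exact Real.log_pos (by linarith)

lemma Zfac_eq (n : ℕ) (u : Vx n) : Zfac n u = (∑ w, ((tdist n u w : ℝ) ^ 2)⁻¹)⁻¹ := by
  rw [Zfac, sum_filter_of_ne]
  rintro w _ h rfl
  simp [tdist_self] at h

/-- The probability that `u` chooses `v`. -/
noncomputable def choiceProb (n : ℕ) (u v : Vx n) : ℝ := Zfac n u * ((tdist n u v : ℝ) ^ 2)⁻¹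

lemma Zfac_nonneg (n : ℕ) (u : Vx n) : 0 ≤ Zfac n u := by
  rw [Zfac_eq]
  positivity

lemma choiceProb_nonneg (n : ℕ) (u v : Vx n) : 0 ≤ choiceProb n u v :=
  mul_nonneg (Zfac_nonneg n u) (by positivity)

lemma sum_choiceProb (n : ℕ) (hn : 3 ≤ n) (u : Vx n) : ∑ v, choiceProb n u v = 1 := by
  simp only [choiceProb]
  rw [← mul_sum, Zfac_eq]
  have := log_half_pos n hn
  exact inv_mul_cancel₀ (by linarith [four_mul_log_le_sum n hn u])

lemma choiceProb_le (n : ℕ) (hn : 3 ≤ n) (u v : Vx n) :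
    choiceProb n u v ≤ (4 * Real.log ((n : ℝ) / 2))⁻¹ * ((tdist n u v : ℝ) ^ 2)⁻¹ := by
  have := log_half_pos n hn
  rw [choiceProb, Zfac_eq]
  gcongr
  exact four_mul_log_le_sum n hn u

lemma mass_eq (n : ℕ) (c : Vx n → Vx n) : mass n c = ∏ u, choiceProb n u (c u) := by
  refine prod_congr rfl fun u _ => ?_
  split_ifs with h
  · simp [choiceProb, h, tdist_self]
  · rfl

lemma mass_nonneg (n : ℕ) (c : Vx n → Vx n) : 0 ≤ mass n c := by
  rw [mass_eq]
  exact prod_nonneg fun u _ => choiceProb_nonneg n u _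

lemma Pr_le_sum_of_subset {n : ℕ} {ι : Type*} (s : Finset ι) (E : Set (Vx n → Vx n))
    (F : ι → Set (Vx n → Vx n)) (h : ∀ c ∈ E, ∃ i ∈ s, c ∈ F i) :
    Pr n E ≤ ∑ i ∈ s, Pr n (F i) := by
  simp only [Pr]
  rw [sum_comm]
  refine sum_le_sum fun c _ => ?_
  have hnn : ∀ i ∈ s, 0 ≤ if c ∈ F i then mass n c else 0 := fun i _ => by
    split_ifs
    exacts [mass_nonneg n c, le_rfl]
  split_ifs with hc
  · obtain ⟨i, hi, hci⟩ := h c hc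
    simpa [hci] using single_le_sum hnn hi
  · exact sum_nonneg hnn

/-- Choices made by two distinct vertices are independent. -/
lemma Pr_choice_pair (n : ℕ) (hn : 3 ≤ n) {x x' : Vx n} (hx : x ≠ x') (y y' : Vx n) :
    Pr n {c | c x = y ∧ c x' = y'} = choiceProb n x y * choiceProb n x' y' := by
  set t : Vx n → Finset (Vx n) := fun v => if v = x then {y} else if v = x' then {y'} else univ
    with ht
  have hS : ∀ c, c ∈ {c : Vx n → Vx n | c x = y ∧ c x' = y'} ↔ c ∈ Fintype.piFinset t := by
    intro c
    simp only [Fintype.mem_piFinset, Set.mem_ofPred_eq, ht]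
    constructor
    · rintro ⟨h, h'⟩ v
      split_ifs with h1 h2
      · simp [h1, h]
      · simp [h2, h']
      · simp
    · intro h
      exact ⟨by simpa using h x, by simpa [hx.symm] using h x'⟩
  have hPr : Pr n {c | c x = y ∧ c x' = y'} = ∑ c ∈ Fintype.piFinset t, mass n c := by
    rw [← univ_inter (Fintype.piFinset t), ← sum_ite_mem]
    refine sum_congr rfl fun c _ => ?_
    by_cases h : c ∈ Fintype.piFinset t
    · rw [if_pos h, if_pos ((hS c).2 h)]
    · rw [if_neg h, if_neg (mt (hS c).1 h)]
  rw [hPr]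
  simp only [mass_eq]
  rw [← prod_univ_sum, Fintype.prod_eq_mul x x' hx]
  · simp [ht, hx.symm]
  · rintro v ⟨h1, h2⟩
    simp [ht, h1, h2, sum_choiceProb n hn]

lemma Pr_edge_pair_le (n : ℕ) (hn : 3 ≤ n) {u a b e : Vx n} (hua : u ≠ a) (hub : u ≠ b)
    (hea : e ≠ a) (heb : e ≠ b) :
    Pr n {c | (c u = e ∨ c e = u) ∧ (c a = b ∨ c b = a)} ≤
      2 * ((4 * Real.log ((n : ℝ) / 2))⁻¹) ^ 2 *
        (((tdist n u e : ℝ) ^ 4)⁻¹ + ((tdist n a b : ℝ) ^ 4)⁻¹) := by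
  set K := (4 * Real.log ((n : ℝ) / 2))⁻¹
  have hK0 : 0 ≤ K := by
    have := log_half_pos n hn
    positivity
  have key := Pr_le_sum_of_subset
    (({(u, e), (e, u)} : Finset (Vx n × Vx n)) ×ˢ ({(a, b), (b, a)} : Finset (Vx n × Vx n)))
    {c | (c u = e ∨ c e = u) ∧ (c a = b ∨ c b = a)}
    (fun p => {c | c p.1.1 = p.1.2 ∧ c p.2.1 = p.2.2}) (by
      rintro c ⟨h | h, h' | h'⟩
      · exact ⟨((u, e), (a, b)), by simp, h, h'⟩
      · exact ⟨((u, e), (b, a)), by simp, h, h'⟩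
      · exact ⟨((e, u), (a, b)), by simp, h, h'⟩
      · exact ⟨((e, u), (b, a)), by simp, h, h'⟩)
  refine key.trans ?_
  set D := ((tdist n u e : ℝ) ^ 2)⁻¹ with hD
  set D' := ((tdist n a b : ℝ) ^ 2)⁻¹ with hD'
  have hbound : ∀ p ∈ (({(u, e), (e, u)} : Finset (Vx n × Vx n)) ×ˢ
      ({(a, b), (b, a)} : Finset (Vx n × Vx n))),
      Pr n {c | c p.1.1 = p.1.2 ∧ c p.2.1 = p.2.2} ≤ (K * D) * (K * D') := by
    rintro ⟨p, q⟩ hpq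
    simp only [mem_product, mem_insert, mem_singleton] at hpq
    have hp : choiceProb n p.1 p.2 ≤ K * D := by
      rcases hpq.1 with rfl | rfl
      · exact choiceProb_le n hn _ _
      · simpa only [hD, tdist_comm n u e] using choiceProb_le n hn e u
    have hq : choiceProb n q.1 q.2 ≤ K * D' := by
      rcases hpq.2 with rfl | rfl
      · exact choiceProb_le n hn _ _
      · simpa only [hD', tdist_comm n a b] using choiceProb_le n hn b a
    have hne : p.1 ≠ q.1 := by
      rcases hpq with ⟨rfl | rfl, rfl | rfl⟩ <;> assumption
    rw [Pr_choice_pair n hn hne]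
    exact mul_le_mul hp hq (choiceProb_nonneg n _ _) (by positivity)
  have hcard : ((({(u, e), (e, u)} : Finset (Vx n × Vx n)) ×ˢ
      ({(a, b), (b, a)} : Finset (Vx n × Vx n))).card : ℝ) ≤ 4 := by
    rw [card_product]
    exact_mod_cast Nat.mul_le_mul (card_le_two (a := (u, e))) (card_le_two (a := (a, b)))
  have h4 : ∀ x : ℝ, (x ^ 4)⁻¹ = ((x ^ 2)⁻¹) ^ 2 := fun x => by
    rw [← inv_pow, ← inv_pow, ← pow_mul]
  calc _ ≤ _ := sum_le_card_nsmul _ _ _ hbound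
    _ ≤ 4 * ((K * D) * (K * D')) := by
        rw [nsmul_eq_mul]
        gcongr
    _ ≤ _ := by
        rw [h4, h4]
        nlinarith [mul_nonneg (sq_nonneg K) (sq_nonneg (D - D'))]

/-- Triples `(a, e, b)` with `a` adjacent to `u`, `b` adjacent to `e` in the torus. -/
noncomputable def localPairs (n : ℕ) (u : Vx n) : Finset (Vx n × Vx n × Vx n) :=
  univ.filter fun t => tdist n u t.1 = 1 ∧ tdist n t.2.1 t.2.2 = 1

lemma sum_localPairs (n : ℕ) (u : Vx n) (g : Vx n × Vx n × Vx n → ℝ) :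
    ∑ t ∈ localPairs n u, g t = ∑ a ∈ univ.filter (fun a => tdist n u a = 1),
      ∑ e, ∑ b ∈ univ.filter (fun b => tdist n e b = 1), g (a, e, b) := by
  simp only [localPairs, sum_filter, ite_and]
  rw [Fintype.sum_prod_type]
  refine sum_congr rfl fun a _ => ?_
  rw [Fintype.sum_prod_type]
  split_ifs <;> simp

lemma sum_neighbors_const_le (n : ℕ) (u : Vx n) {M : ℝ} (hM : 0 ≤ M) (g : Vx n → ℝ)
    (hg : ∀ a, g a ≤ M) : ∑ a ∈ univ.filter (fun a => tdist n u a = 1), g a ≤ 4 * M := by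
  calc _ ≤ _ := sum_le_card_nsmul _ _ M fun a _ => hg a
    _ ≤ 4 * M := by
        rw [nsmul_eq_mul]
        gcongr
        exact_mod_cast card_tdist_sphere_le n u 1 one_ne_zero

lemma zeta3_nonneg : 0 ≤ zeta3 := tsum_nonneg fun i => by positivity

lemma sum_localPairs_le (n : ℕ) (u : Vx n) :
    ∑ t ∈ localPairs n u,
      (((tdist n u t.2.1 : ℝ) ^ 4)⁻¹ + ((tdist n t.1 t.2.2 : ℝ) ^ 4)⁻¹) ≤ 128 * zeta3 := by
  have hz := zeta3_nonneg
  rw [sum_add_distrib, sum_localPairs, sum_localPairs]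
  have h1 : ∑ a ∈ univ.filter (fun a => tdist n u a = 1),
      ∑ e, ∑ b ∈ univ.filter (fun b => tdist n e b = 1), ((tdist n u e : ℝ) ^ 4)⁻¹
      ≤ 4 * (16 * zeta3) := by
    refine sum_neighbors_const_le n u (by positivity) _ fun _ => ?_
    calc _ ≤ ∑ e, 4 * ((tdist n u e : ℝ) ^ 4)⁻¹ := sum_le_sum fun e _ =>
          sum_neighbors_const_le n e (by positivity) _ fun _ => le_rfl
      _ ≤ _ := by
          rw [← mul_sum]
          linarith [sum_tdist_pow_four_inv_le n u]
  have h2 : ∑ a ∈ univ.filter (fun a => tdist n u a = 1),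
      ∑ e, ∑ b ∈ univ.filter (fun b => tdist n e b = 1), ((tdist n a b : ℝ) ^ 4)⁻¹
      ≤ 4 * (16 * zeta3) := by
    refine sum_neighbors_const_le n u (by positivity) _ fun a => ?_
    calc _ = ∑ b, ∑ e ∈ univ.filter (fun e => tdist n b e = 1), ((tdist n a b : ℝ) ^ 4)⁻¹ := by
          refine sum_comm' fun x y => ?_
          simp [tdist_comm n x y]
      _ ≤ ∑ b, 4 * ((tdist n a b : ℝ) ^ 4)⁻¹ := sum_le_sum fun b _ =>
          sum_neighbors_const_le n b (by positivity) _ fun _ => le_rfl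
      _ ≤ _ := by
          rw [← mul_sum]
          linarith [sum_tdist_pow_four_inv_le n a]
  linarith

lemma edgeKind_symm {n : ℕ} {c : Vx n → Vx n} {x y : Vx n} {w : Bool} (h : edgeKind n c x y w) :
    edgeKind n c y x w := by
  obtain ⟨⟨h1, h2⟩, h3⟩ := h
  rw [tdist_comm] at h2 h3
  exact ⟨⟨h1.symm, h2.imp_right Or.symm⟩, h3⟩

/-- Traversing a rooted four-cycle backwards reverses its pattern. -/
lemma cyclePat_reverse {n : ℕ} {c : Vx n → Vx n} {u : Vx n} {p₁ p₂ p₃ p₄ : Bool}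
    (h : cyclePat n c u p₁ p₂ p₃ p₄) : cyclePat n c u p₄ p₃ p₂ p₁ := by
  obtain ⟨a, b, e, hab, hae, hbe, hau, hbu, heu, h1, h2, h3, h4⟩ := h
  exact ⟨e, b, a, hbe.symm, hae.symm, hab.symm, heu, hbu, hau, edgeKind_symm h4,
    edgeKind_symm h3, edgeKind_symm h2, edgeKind_symm h1⟩

lemma edgeKind.tdist_eq_one {n : ℕ} {c : Vx n → Vx n} {x y : Vx n}
    (h : edgeKind n c x y false) : tdist n x y = 1 := h.2.2 rfl

lemma edgeKind.choice {n : ℕ} {c : Vx n → Vx n} {x y : Vx n}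
    (h : edgeKind n c x y true) : c x = y ∨ c y = x :=
  h.1.2.resolve_left fun h1 => absurd (h.2.1 h1) (by decide)

/-- Probability bound for the event `E4ᵤ`. -/
theorem prob_E4 :
    ∀ n : ℕ, 3 ≤ n → ∀ u : Vx n,
      Pr n {c | cyclePat n c u false true false true ∨ cyclePat n c u true false true false} <
        (16 * zeta3 + 5 / 4) * (Real.log ((n : ℝ) / 2) ^ 2)⁻¹ := by
  intro n hn u
  have hL := log_half_pos n hn
  set L := Real.log ((n : ℝ) / 2)
  set S := (localPairs n u).filter
    (fun t => u ≠ t.1 ∧ u ≠ t.2.2 ∧ t.2.1 ≠ t.1 ∧ t.2.1 ≠ t.2.2) with hS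
  have hcover := Pr_le_sum_of_subset S
    {c | cyclePat n c u false true false true ∨ cyclePat n c u true false true false}
    (fun t => {c | (c u = t.2.1 ∨ c t.2.1 = u) ∧ (c t.1 = t.2.2 ∨ c t.2.2 = t.1)}) (by
      intro c hc
      have hc : cyclePat n c u false true false true := hc.elim id cyclePat_reverse
      obtain ⟨a, b, e, hab, hae, hbe, hau, hbu, heu, h1, h2, h3, h4⟩ := hc
      refine ⟨(a, e, b), ?_, (edgeKind_symm h4).choice, h2.choice⟩
      simp only [hS, localPairs, mem_filter, mem_univ, true_and]
      exact ⟨⟨h1.tdist_eq_one, (edgeKind_symm h3).tdist_eq_one⟩, hau.symm, hbu.symm, hae.symm,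
        hbe.symm⟩)
  calc _ ≤ _ := hcover
    _ ≤ ∑ t ∈ S, 2 * ((4 * L)⁻¹) ^ 2 *
        (((tdist n u t.2.1 : ℝ) ^ 4)⁻¹ + ((tdist n t.1 t.2.2 : ℝ) ^ 4)⁻¹) := by
        refine sum_le_sum fun t ht => ?_
        obtain ⟨hua, hub, hea, heb⟩ := (mem_filter.1 ht).2
        exact Pr_edge_pair_le n hn hua hub hea heb
    _ ≤ ∑ t ∈ localPairs n u, 2 * ((4 * L)⁻¹) ^ 2 *
        (((tdist n u t.2.1 : ℝ) ^ 4)⁻¹ + ((tdist n t.1 t.2.2 : ℝ) ^ 4)⁻¹) :=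
        sum_le_sum_of_subset_of_nonneg (filter_subset _ _) fun _ _ _ => by positivity
    _ ≤ 2 * ((4 * L)⁻¹) ^ 2 * (128 * zeta3) := by
        rw [← mul_sum]
        gcongr
        exact sum_localPairs_le n u
    _ = 16 * zeta3 * (L ^ 2)⁻¹ := by
        field_simp
        ring
    _ < (16 * zeta3 + 5 / 4) * (L ^ 2)⁻¹ := by
        gcongr
        linarith
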